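/- arXiv:2501.06610 — 2 statements merged into one kernel-verified Lean document; each statement's English description precedes it below -/
import Mathlib

section
/- Let d ≥ 1, let (Ω, μ) be a probability space and f : ℝ^d × Ω → ℝ be such that for every ω the function f(·, ω) is twice continuously differentiable with M_f-Lipschitz Hessian; let F : ℝ^d → ℝ be twice continuously differentiable with M_F-Lipschitz Hessian where M_F ≤ M_f; assume E_ω[∇f(x, ω)] = ∇F(x) and E_ω[‖∇f(x, ω) − ∇F(x)‖²] ≤ β₁‖∇F(x)‖² + β₂ for constants β₁, β₂ ≥ 0. Fix x, u ∈ ℝ^d and ν > 0, and define c(ω) := (f(x + νu, ω) − f(x − νu, ω))/(2ν) − (F(x + νu) − F(x − νu))/(2ν). Then E_ω[c(ω)²] ≤ 2(β₁‖∇F(x)‖² + β₂)‖u‖² + (2/9) M_f² ν⁴ ‖u‖⁶. -/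
open MeasureTheory
open scoped RealInnerProductSpace

/-- If `‖φ'(t)‖ ≤ B t ^ n` on `[0, 1]` and `φ 0 = 0`, then `‖φ(t)‖ ≤ B t ^ (n + 1) / (n + 1)`. -/
theorem norm_le_pow_succ_of_norm_deriv_le_pow {E : Type*} [NormedAddCommGroup E] [NormedSpace ℝ E]
    {φ φ' : ℝ → E} {B : ℝ} {n : ℕ} (hφ : ∀ t, HasDerivAt φ (φ' t) t) (h0 : φ 0 = 0)
    (hB : ∀ t ∈ Set.Ico (0 : ℝ) 1, ‖φ' t‖ ≤ B * t ^ n) {t : ℝ} (ht : t ∈ Set.Icc (0 : ℝ) 1) :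
    ‖φ t‖ ≤ B * t ^ (n + 1) / (n + 1) := by
  have hpow : ∀ s : ℝ, HasDerivAt (fun s : ℝ => B * s ^ (n + 1) / (n + 1)) (B * s ^ n) s := by
    intro s
    refine (((hasDerivAt_pow (n + 1) s).const_mul B).div_const ((n : ℝ) + 1)).congr_deriv ?_
    have : (n : ℝ) + 1 ≠ 0 := by positivity
    push_cast
    field_simp
  exact image_norm_le_of_norm_deriv_right_le_deriv_boundary
    (fun s _ => (hφ s).continuousAt.continuousWithinAt)
    (fun s _ => (hφ s).hasDerivWithinAt) (by simp [h0]) hpow hB ht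

section CentralDifference

variable {E : Type*} [NormedAddCommGroup E] [NormedSpace ℝ E]

theorem hasDerivAt_comp_add_smul {G : Type*} [NormedAddCommGroup G] [NormedSpace ℝ G]
    {g : E → G} (hg : Differentiable ℝ g) (x h : E) (t : ℝ) :
    HasDerivAt (fun t : ℝ => g (x + t • h)) (fderiv ℝ g (x + t • h) h) t := by
  have hline : HasDerivAt (fun t : ℝ => x + t • h) h t := by
    simpa using ((hasDerivAt_id t).smul_const h).const_add x
  exact (hg _).hasFDerivAt.comp_hasDerivAt t hline

/-- A function with `M`-Lipschitz Hessian is approximated by its symmetric differences to third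
order. -/
theorem abs_central_diff_sub_fderiv_le {g : E → ℝ} {M : ℝ} (hg : ContDiff ℝ 2 g)
    (hLip : ∀ x y : E, ‖iteratedFDeriv ℝ 2 g x - iteratedFDeriv ℝ 2 g y‖ ≤ M * ‖x - y‖)
    (x h : E) : |g (x + h) - g (x - h) - 2 * fderiv ℝ g x h| ≤ M * ‖h‖ ^ 3 / 3 := by
  have hg1 : Differentiable ℝ g := hg.differentiable (by norm_num)
  have hg2 : Differentiable ℝ (fderiv ℝ g) :=
    (hg.fderiv_right (m := 1) (by norm_num)).differentiable (by norm_num)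
  have hfirst (k : E) (t : ℝ) := hasDerivAt_comp_add_smul hg1 x k t
  have hsecond (k : E) (t : ℝ) :=
    (hasDerivAt_comp_add_smul hg2 x k t).clm_apply (hasDerivAt_const t h)
  have hd1 (t : ℝ) : HasDerivAt
      (fun t : ℝ => g (x + t • h) - g (x + t • (-h)) - t * (2 * fderiv ℝ g x h))
      (fderiv ℝ g (x + t • h) h + fderiv ℝ g (x + t • (-h)) h - 2 * fderiv ℝ g x h) t := by
    refine (((hfirst h t).sub (hfirst (-h) t)).sub
      ((hasDerivAt_id t).mul_const (2 * fderiv ℝ g x h))).congr_deriv ?_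
    simp
  have hd2 (t : ℝ) : HasDerivAt
      (fun t : ℝ => fderiv ℝ g (x + t • h) h + fderiv ℝ g (x + t • (-h)) h - 2 * fderiv ℝ g x h)
      (fderiv ℝ (fderiv ℝ g) (x + t • h) h h - fderiv ℝ (fderiv ℝ g) (x + t • (-h)) h h) t := by
    refine (((hsecond h t).add (hsecond (-h) t)).sub_const (2 * fderiv ℝ g x h)).congr_deriv ?_
    simp [sub_eq_add_neg]
  have hbound2 : ∀ t ∈ Set.Ico (0 : ℝ) 1,
      ‖fderiv ℝ (fderiv ℝ g) (x + t • h) h h - fderiv ℝ (fderiv ℝ g) (x + t • (-h)) h h‖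
        ≤ 2 * M * ‖h‖ ^ 3 * t ^ 1 := by
    intro t ht
    have happ := (iteratedFDeriv ℝ 2 g (x + t • h)
      - iteratedFDeriv ℝ 2 g (x + t • (-h))).le_opNorm ![h, h]
    simp only [sub_apply, iteratedFDeriv_two_apply, Fin.prod_univ_two,
      Matrix.cons_val_zero, Matrix.cons_val_one] at happ
    have hdist : ‖(x + t • h) - (x + t • (-h))‖ = 2 * t * ‖h‖ := by
      have : (x + t • h) - (x + t • (-h)) = (2 * t) • h := by module
      rw [this, norm_smul, Real.norm_of_nonneg (by linarith [ht.1])]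
    have hL := hLip (x + t • h) (x + t • (-h))
    rw [hdist] at hL
    calc _ ≤ _ := happ
      _ ≤ M * (2 * t * ‖h‖) * (‖h‖ * ‖h‖) := by gcongr
      _ = _ := by ring
  have hbound1 : ∀ t ∈ Set.Ico (0 : ℝ) 1,
      ‖fderiv ℝ g (x + t • h) h + fderiv ℝ g (x + t • (-h)) h - 2 * fderiv ℝ g x h‖
        ≤ M * ‖h‖ ^ 3 * t ^ 2 := by
    intro t ht
    have := norm_le_pow_succ_of_norm_deriv_le_pow hd2 (by simp; ring) hbound2
      (Set.Ico_subset_Icc_self ht)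
    refine this.trans_eq ?_
    norm_num
    ring
  have := norm_le_pow_succ_of_norm_deriv_le_pow hd1 (by simp) hbound1
    (Set.right_mem_Icc.2 zero_le_one)
  norm_num [← sub_eq_add_neg] at this
  exact this

/-- The error of the central finite-difference quotient as an estimate of the directional
derivative. -/
theorem abs_central_diff_quotient_sub_fderiv_le {g : E → ℝ} {M : ℝ} (hg : ContDiff ℝ 2 g)
    (hLip : ∀ x y : E, ‖iteratedFDeriv ℝ 2 g x - iteratedFDeriv ℝ 2 g y‖ ≤ M * ‖x - y‖)
    (x u : E) {ν : ℝ} (hν : 0 < ν) :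
    |(g (x + ν • u) - g (x - ν • u)) / (2 * ν) - fderiv ℝ g x u| ≤ M * ν ^ 2 * ‖u‖ ^ 3 / 6 := by
  have h := abs_central_diff_sub_fderiv_le hg hLip x (ν • u)
  rw [map_smul, smul_eq_mul, norm_smul, Real.norm_of_nonneg hν.le] at h
  have hq : (g (x + ν • u) - g (x - ν • u)) / (2 * ν) - fderiv ℝ g x u
      = (g (x + ν • u) - g (x - ν • u) - 2 * (ν * fderiv ℝ g x u)) / (2 * ν) := by
    field_simp
  rw [hq, abs_div, abs_of_pos (by positivity : 0 < 2 * ν), div_le_iff₀ (by positivity)]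
  exact h.trans_eq (by ring)

end CentralDifference

theorem stochastic_central_diff_quotient_variance_bound
    (d : ℕ) (hd : 1 ≤ d)
    {Ω : Type*} [MeasurableSpace Ω] (μ : Measure Ω) [IsProbabilityMeasure μ]
    (f : EuclideanSpace ℝ (Fin d) → Ω → ℝ)
    (F : EuclideanSpace ℝ (Fin d) → ℝ) (Mf MF : ℝ)
    (hMf : 0 ≤ Mf) (hMF : 0 ≤ MF) (hMFf : MF ≤ Mf)
    (hf : ∀ ω, ContDiff ℝ 2 (fun y => f y ω))
    (hLipf : ∀ ω, ∀ x y : EuclideanSpace ℝ (Fin d),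
      ‖iteratedFDeriv ℝ 2 (fun z => f z ω) x - iteratedFDeriv ℝ 2 (fun z => f z ω) y‖
        ≤ Mf * ‖x - y‖)
    (hF : ContDiff ℝ 2 F)
    (hLipF : ∀ x y : EuclideanSpace ℝ (Fin d),
      ‖iteratedFDeriv ℝ 2 F x - iteratedFDeriv ℝ 2 F y‖ ≤ MF * ‖x - y‖)
    (β₁ β₂ : ℝ) (hβ₁ : 0 ≤ β₁) (hβ₂ : 0 ≤ β₂)
    (hgradInt : ∀ y : EuclideanSpace ℝ (Fin d),
      Integrable (fun ω => gradient (fun z => f z ω) y) μ)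
    (hmean : ∀ y : EuclideanSpace ℝ (Fin d),
      (∫ ω, gradient (fun z => f z ω) y ∂μ) = gradient F y)
    (hvarInt : ∀ y : EuclideanSpace ℝ (Fin d),
      Integrable (fun ω => ‖gradient (fun z => f z ω) y - gradient F y‖ ^ 2) μ)
    (hvar : ∀ y : EuclideanSpace ℝ (Fin d),
      (∫ ω, ‖gradient (fun z => f z ω) y - gradient F y‖ ^ 2 ∂μ)
        ≤ β₁ * ‖gradient F y‖ ^ 2 + β₂)
    (x u : EuclideanSpace ℝ (Fin d)) (ν : ℝ) (hν : 0 < ν)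
    (c : Ω → ℝ)
    (hc : ∀ ω, c ω = (f (x + ν • u) ω - f (x - ν • u) ω) / (2 * ν)
                   - (F (x + ν • u) - F (x - ν • u)) / (2 * ν))
    (hcInt : Integrable (fun ω => (c ω) ^ 2) μ) :
    (∫ ω, (c ω) ^ 2 ∂μ)
      ≤ 2 * (β₁ * ‖gradient F x‖ ^ 2 + β₂) * ‖u‖ ^ 2
        + (2 / 9) * Mf ^ 2 * ν ^ 4 * ‖u‖ ^ 6 := by
  have hpoint : ∀ ω, (c ω) ^ 2 ≤
      2 * ‖u‖ ^ 2 * ‖gradient (fun z => f z ω) x - gradient F x‖ ^ 2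
        + (2 / 9) * Mf ^ 2 * ν ^ 4 * ‖u‖ ^ 6 := by
    intro ω
    have hfω := abs_central_diff_quotient_sub_fderiv_le (hf ω) (hLipf ω) x u hν
    have hFx := abs_central_diff_quotient_sub_fderiv_le hF hLipF x u hν
    have hinner : |fderiv ℝ (fun z => f z ω) x u - fderiv ℝ F x u|
        ≤ ‖gradient (fun z => f z ω) x - gradient F x‖ * ‖u‖ := by
      have := abs_real_inner_le_norm (gradient (fun z => f z ω) x - gradient F x) u
      simpa [inner_sub_left, gradient] using this
    have hMM : MF * ν ^ 2 * ‖u‖ ^ 3 / 6 ≤ Mf * ν ^ 2 * ‖u‖ ^ 3 / 6 := by gcongr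
    have habs : |c ω| ≤ ‖gradient (fun z => f z ω) x - gradient F x‖ * ‖u‖
        + Mf * ν ^ 2 * ‖u‖ ^ 3 / 3 := by
      rw [hc ω]
      rw [abs_le] at hfω hFx hinner ⊢
      constructor <;> linarith [hfω.1, hfω.2, hFx.1, hFx.2, hinner.1, hinner.2]
    calc (c ω) ^ 2 = |c ω| ^ 2 := (sq_abs _).symm
      _ ≤ (‖gradient (fun z => f z ω) x - gradient F x‖ * ‖u‖
          + Mf * ν ^ 2 * ‖u‖ ^ 3 / 3) ^ 2 := by gcongr
      _ ≤ 2 * ((‖gradient (fun z => f z ω) x - gradient F x‖ * ‖u‖) ^ 2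
          + (Mf * ν ^ 2 * ‖u‖ ^ 3 / 3) ^ 2) := add_sq_le
      _ = _ := by ring
  have hint := (hvarInt x).const_mul (2 * ‖u‖ ^ 2)
  calc (∫ ω, (c ω) ^ 2 ∂μ)
      ≤ ∫ ω, (2 * ‖u‖ ^ 2 * ‖gradient (fun z => f z ω) x - gradient F x‖ ^ 2
        + (2 / 9) * Mf ^ 2 * ν ^ 4 * ‖u‖ ^ 6) ∂μ :=
        integral_mono hcInt (hint.add (integrable_const _)) hpoint
    _ = 2 * ‖u‖ ^ 2 * (∫ ω, ‖gradient (fun z => f z ω) x - gradient F x‖ ^ 2 ∂μ)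
        + (2 / 9) * Mf ^ 2 * ν ^ 4 * ‖u‖ ^ 6 := by
        rw [integral_add hint (integrable_const _), integral_const_mul]
        simp
    _ ≤ 2 * ‖u‖ ^ 2 * (β₁ * ‖gradient F x‖ ^ 2 + β₂)
        + (2 / 9) * Mf ^ 2 * ν ^ 4 * ‖u‖ ^ 6 := by
        gcongr
        exact hvar x
    _ = _ := by ring
end

section
/- Let d ≥ 1 and 1 ≤ N ≤ d, let F : ℝ^d → ℝ be twice continuously differentiable with M-Lipschitz Hessian, let ν > 0 and x ∈ ℝ^d. Let (Θ, P) be a probability space and for each θ ∈ Θ let (u_1(θ), …, u_d(θ)) be an orthonormal basis of ℝ^d, measurably in θ, and define b_j(θ) := (F(x + νu_j(θ)) − F(x − νu_j(θ)))/(2ν). Then, averaging over θ and uniformly over all N-element subsets T of {1, …, d}: E_θ[ (1 / C(d,N)) ∑_{|T| = N} ‖(d/N) ∑_{j ∈ T} b_j(θ) u_j(θ)‖² ] ≤ (2d/N)(d M² ν⁴ / 36) + (2d/N) ‖∇F(x)‖². -/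
open MeasureTheory
open scoped RealInnerProductSpace

/-- The number of `(k + 1)`-element subsets of `s` containing a given `a ∈ s`. -/
theorem Finset.card_filter_mem_powersetCard_succ {α : Type*} [DecidableEq α] {s : Finset α} {a : α}
    (ha : a ∈ s) (k : ℕ) :
    ((s.powersetCard (k + 1)).filter (a ∈ ·)).card = (s.card - 1).choose k := by
  have hcompl : (s.powersetCard (k + 1)).filter (a ∉ ·) = (s.erase a).powersetCard (k + 1) := by
    ext t
    simp only [Finset.mem_filter, Finset.mem_powersetCard, Finset.subset_erase]
    tauto
  have hsplit := Finset.card_filter_add_card_filter_not (s := s.powersetCard (k + 1)) (a ∈ ·)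
  rw [hcompl, Finset.card_powersetCard, Finset.card_powersetCard, Finset.card_erase_of_mem ha]
    at hsplit
  obtain ⟨m, hm⟩ : ∃ m, s.card = m + 1 :=
    Nat.exists_eq_succ_of_ne_zero (Finset.card_ne_zero_of_mem ha)
  rw [hm, Nat.choose_succ_succ] at hsplit
  rw [hm]
  simp only [Nat.add_sub_cancel, Nat.succ_eq_add_one] at *
  omega

theorem Finset.sum_powersetCard_succ_sum {α R : Type*} [AddCommMonoid R]
    (s : Finset α) (k : ℕ) (f : α → R) :
    ∑ t ∈ s.powersetCard (k + 1), ∑ a ∈ t, f a = (s.card - 1).choose k • ∑ a ∈ s, f a := by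
  classical
  rw [Finset.sum_comm' (t' := s) (s' := fun a => (s.powersetCard (k + 1)).filter (a ∈ ·)),
    Finset.smul_sum]
  · refine Finset.sum_congr rfl fun a ha => ?_
    rw [Finset.sum_const, Finset.card_filter_mem_powersetCard_succ ha]
  · intro t a
    simp only [Finset.mem_filter, Finset.mem_powersetCard]
    exact ⟨fun h => ⟨h, h.1.1 h.2⟩, fun h => h.1⟩

/-- Averaging the squared norm of `(d / N) ∑_{j ∈ T} c j • v j` over the `N`-element sets `T`. -/
theorem Orthonormal.average_norm_sq_sum_powersetCard {E : Type*} [NormedAddCommGroup E]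
    [InnerProductSpace ℝ E] {d N : ℕ} (hN : 1 ≤ N) (hNd : N ≤ d) {v : Fin d → E}
    (hv : Orthonormal ℝ v) (c : Fin d → ℝ) :
    (1 / (d.choose N : ℝ)) * ∑ T ∈ Finset.powersetCard N (Finset.univ : Finset (Fin d)),
      ‖((d : ℝ) / (N : ℝ)) • ∑ j ∈ T, c j • v j‖ ^ 2 = (d / N : ℝ) * ∑ j, c j ^ 2 := by
  obtain ⟨k, rfl⟩ : ∃ k, N = k + 1 := ⟨N - 1, by omega⟩
  obtain ⟨m, rfl⟩ : ∃ m, d = m + 1 := ⟨d - 1, by omega⟩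
  have hnorm (T : Finset (Fin (m + 1))) :
      ‖(((m + 1 : ℕ) : ℝ) / ((k + 1 : ℕ) : ℝ)) • ∑ j ∈ T, c j • v j‖ ^ 2 =
        (((m + 1 : ℕ) : ℝ) / ((k + 1 : ℕ) : ℝ)) ^ 2 * ∑ j ∈ T, c j ^ 2 := by
    rw [norm_smul, mul_pow, Real.norm_eq_abs, sq_abs, ← real_inner_self_eq_norm_sq, hv.inner_sum]
    simp [sq]
  simp_rw [hnorm]
  rw [← Finset.mul_sum, Finset.sum_powersetCard_succ_sum]
  have hchoose : ((m : ℝ) + 1) * m.choose k = (m + 1).choose (k + 1) * (k + 1) := by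
    exact_mod_cast Nat.add_one_mul_choose_eq m k
  have hpos : (0 : ℝ) < (m + 1).choose (k + 1) := by exact_mod_cast Nat.choose_pos hNd
  simp only [Finset.card_univ, Fintype.card_fin, Nat.add_sub_cancel, nsmul_eq_mul]
  push_cast
  field_simp
  linear_combination (∑ j, c j ^ 2) * hchoose

/-- The central difference of a `C²` function with `M`-Lipschitz second derivative approximates
the directional derivative to second order in the step. -/
theorem abs_central_difference_sub_fderiv_le {E : Type*} [NormedAddCommGroup E] [NormedSpace ℝ E]
    {F : E → ℝ} {M : ℝ} (hF : ContDiff ℝ 2 F)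
    (hLip : ∀ x y, ‖iteratedFDeriv ℝ 2 F x - iteratedFDeriv ℝ 2 F y‖ ≤ M * ‖x - y‖)
    {ν : ℝ} (hν : 0 < ν) (x : E) {v : E} (hv : ‖v‖ = 1) :
    |(F (x + ν • v) - F (x - ν • v)) / (2 * ν) - fderiv ℝ F x v| ≤ M * ν ^ 2 / 6 := by
  have hline (s t : ℝ) : HasDerivAt (fun t : ℝ => x + (s * t) • v) (s • v) t := by
    simpa using (((hasDerivAt_id t).const_mul s).smul_const v).const_add x
  have h1 (s t : ℝ) : HasDerivAt (fun t : ℝ => F (x + (s * t) • v))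
      (s * fderiv ℝ F (x + (s * t) • v) v) t := by
    have h : HasDerivAt (fun t : ℝ => F (x + (s * t) • v))
        (fderiv ℝ F (x + (s * t) • v) (s • v)) t :=
      ((hF.differentiable (by norm_num)) (x + (s * t) • v)).hasFDerivAt.comp_hasDerivAt t
        (hline s t)
    rwa [map_smul, smul_eq_mul] at h
  have h2 (s t : ℝ) : HasDerivAt (fun t : ℝ => fderiv ℝ F (x + (s * t) • v) v)
      (s * iteratedFDeriv ℝ 2 F (x + (s * t) • v) ![v, v]) t := by
    have hd : Differentiable ℝ (fderiv ℝ F) :=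
      (hF.fderiv_right (m := 1) (by norm_num)).differentiable (by norm_num)
    have hcomp : HasDerivAt (fun t : ℝ => fderiv ℝ F (x + (s * t) • v))
        (fderiv ℝ (fderiv ℝ F) (x + (s * t) • v) (s • v)) t :=
      (hd (x + (s * t) • v)).hasFDerivAt.comp_hasDerivAt t (hline s t)
    have h := ((ContinuousLinearMap.apply ℝ ℝ v).hasFDerivAt).comp_hasDerivAt t hcomp
    have heval : s * iteratedFDeriv ℝ 2 F (x + (s * t) • v) ![v, v]
        = ContinuousLinearMap.apply ℝ ℝ v
          (fderiv ℝ (fderiv ℝ F) (x + (s * t) • v) (s • v)) := by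
      simp [iteratedFDeriv_two_apply]
    rw [heval]
    exact h
  have hpow (n : ℕ) (t : ℝ) :
      HasDerivAt (fun t : ℝ => t ^ (n + 1)) ((n + 1 : ℝ) * t ^ n) t := by
    simpa using hasDerivAt_pow (n + 1) t
  have hfirst : ∀ t ∈ Set.Icc 0 ν,
      ‖fderiv ℝ F (x + (1 * t) • v) v + fderiv ℝ F (x + (-1 * t) • v) v
        - 2 * fderiv ℝ F x v‖ ≤ M * t ^ 2 := by
    have hder (t : ℝ) := ((h2 1 t).add (h2 (-1) t)).sub_const (2 * fderiv ℝ F x v)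
    refine image_norm_le_of_norm_deriv_right_le_deriv_boundary
      (fun t _ => (hder t).continuousAt.continuousWithinAt)
      (fun t _ => (hder t).hasDerivWithinAt) (B := fun t => M * t ^ 2) ?_
      (fun t => (hpow 1 t).const_mul M) ?_
    · simp [two_mul]
    · intro t ht
      have hsub : x + (1 * t) • v - (x + (-1 * t) • v) = (2 * t) • v := by module
      calc ‖1 * iteratedFDeriv ℝ 2 F (x + (1 * t) • v) ![v, v]
            + -1 * iteratedFDeriv ℝ 2 F (x + (-1 * t) • v) ![v, v]‖
          = ‖(iteratedFDeriv ℝ 2 F (x + (1 * t) • v)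
              - iteratedFDeriv ℝ 2 F (x + (-1 * t) • v)) ![v, v]‖ := by
            rw [sub_apply]; congr 1; ring
        _ ≤ ‖iteratedFDeriv ℝ 2 F (x + (1 * t) • v)
              - iteratedFDeriv ℝ 2 F (x + (-1 * t) • v)‖ := by
            simpa [Fin.prod_univ_two, hv] using ContinuousMultilinearMap.le_opNorm
              (iteratedFDeriv ℝ 2 F (x + (1 * t) • v)
                - iteratedFDeriv ℝ 2 F (x + (-1 * t) • v)) ![v, v]
        _ ≤ M * ‖x + (1 * t) • v - (x + (-1 * t) • v)‖ := hLip _ _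
        _ = M * ((((1 : ℕ) : ℝ) + 1) * t ^ 1) := by
            rw [hsub, norm_smul, hv, Real.norm_of_nonneg (by linarith [ht.1])]
            push_cast
            ring
  have hzeroth : ‖F (x + (1 * ν) • v) - F (x + (-1 * ν) • v) - 2 * fderiv ℝ F x v * ν‖
      ≤ M / 3 * ν ^ 3 := by
    have hder (t : ℝ) := ((h1 1 t).sub (h1 (-1) t)).sub
      ((hasDerivAt_id t).const_mul (2 * fderiv ℝ F x v))
    refine image_norm_le_of_norm_deriv_right_le_deriv_boundary (a := 0) (b := ν)
      (fun t _ => (hder t).continuousAt.continuousWithinAt)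
      (fun t _ => (hder t).hasDerivWithinAt) (B := fun t => M / 3 * t ^ 3) ?_
      (fun t => (hpow 2 t).const_mul (M / 3)) ?_ ⟨hν.le, le_rfl⟩
    · simp
    · intro t ht
      convert hfirst t ⟨ht.1, ht.2.le⟩ using 1
      · congr 1; ring
      · push_cast; ring
  have hquot : (F (x + ν • v) - F (x - ν • v)) / (2 * ν) - fderiv ℝ F x v
      = (F (x + (1 * ν) • v) - F (x + (-1 * ν) • v) - 2 * fderiv ℝ F x v * ν) / (2 * ν) := by
    rw [one_mul, neg_one_mul, neg_smul, ← sub_eq_add_neg]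
    field_simp
  rw [hquot, abs_div, abs_of_pos (by positivity : 0 < 2 * ν), div_le_iff₀ (by positivity)]
  calc _ ≤ M / 3 * ν ^ 3 := hzeroth
    _ = _ := by ring

theorem randomized_subspace_central_fd_second_moment_bound
    (d N : ℕ) (hd : 1 ≤ d) (hN : 1 ≤ N) (hNd : N ≤ d)
    (F : EuclideanSpace ℝ (Fin d) → ℝ) (M : ℝ) (hM : 0 ≤ M)
    (hF : ContDiff ℝ 2 F)
    (hLip : ∀ x y : EuclideanSpace ℝ (Fin d),
      ‖iteratedFDeriv ℝ 2 F x - iteratedFDeriv ℝ 2 F y‖ ≤ M * ‖x - y‖)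
    (ν : ℝ) (hν : 0 < ν) (x : EuclideanSpace ℝ (Fin d))
    {Θ : Type*} [MeasurableSpace Θ] (P : Measure Θ) [IsProbabilityMeasure P]
    (u : Θ → Fin d → EuclideanSpace ℝ (Fin d))
    (hu : ∀ θ, Orthonormal ℝ (u θ))
    (b : Fin d → Θ → ℝ)
    (hb : ∀ j θ, b j θ = (F (x + ν • u θ j) - F (x - ν • u θ j)) / (2 * ν))
    (hInt : Integrable (fun θ =>
      (1 / (d.choose N : ℝ)) *
        ∑ T ∈ Finset.powersetCard N (Finset.univ : Finset (Fin d)),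
          ‖((d : ℝ) / (N : ℝ)) • ∑ j ∈ T, b j θ • u θ j‖ ^ 2) P) :
    (∫ θ, (1 / (d.choose N : ℝ)) *
        ∑ T ∈ Finset.powersetCard N (Finset.univ : Finset (Fin d)),
          ‖((d : ℝ) / (N : ℝ)) • ∑ j ∈ T, b j θ • u θ j‖ ^ 2 ∂P)
      ≤ (2 * d / N) * (d * M ^ 2 * ν ^ 4 / 36)
        + (2 * d / N) * ‖gradient F x‖ ^ 2 := by
  have hcoeff (θ : Θ) (j : Fin d) :
      b j θ ^ 2 ≤ 2 * (M ^ 2 * ν ^ 4 / 36) + 2 * ‖⟪u θ j, gradient F x⟫‖ ^ 2 := by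
    have hdiff := abs_central_difference_sub_fderiv_le hF hLip hν x ((hu θ).1 j)
    rw [← hb, ← inner_gradient_left, real_inner_comm] at hdiff
    have hsq := sq_le_sq' (abs_le.mp hdiff).1 (abs_le.mp hdiff).2
    rw [Real.norm_eq_abs, sq_abs]
    nlinarith [sq_nonneg (b j θ - 2 * ⟪u θ j, gradient F x⟫)]
  have hbound (θ : Θ) : (1 / (d.choose N : ℝ)) *
      ∑ T ∈ Finset.powersetCard N (Finset.univ : Finset (Fin d)),
        ‖((d : ℝ) / (N : ℝ)) • ∑ j ∈ T, b j θ • u θ j‖ ^ 2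
      ≤ (2 * d / N) * (d * M ^ 2 * ν ^ 4 / 36) + (2 * d / N) * ‖gradient F x‖ ^ 2 := by
    rw [(hu θ).average_norm_sq_sum_powersetCard hN hNd]
    calc (d / N : ℝ) * ∑ j, b j θ ^ 2
        ≤ (d / N : ℝ) * (2 * (d * (M ^ 2 * ν ^ 4 / 36)) + 2 * ‖gradient F x‖ ^ 2) := by
          gcongr
          calc ∑ j, b j θ ^ 2
              ≤ ∑ j, (2 * (M ^ 2 * ν ^ 4 / 36) + 2 * ‖⟪u θ j, gradient F x⟫‖ ^ 2) :=
                Finset.sum_le_sum fun j _ => hcoeff θ j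
            _ = 2 * (d * (M ^ 2 * ν ^ 4 / 36)) + 2 * ∑ j, ‖⟪u θ j, gradient F x⟫‖ ^ 2 := by
                simp only [Finset.sum_add_distrib, ← Finset.mul_sum, Finset.sum_const,
                  Finset.card_univ, Fintype.card_fin, nsmul_eq_mul]
            _ ≤ _ := by
                gcongr
                exact (hu θ).sum_inner_products_le (gradient F x)
      _ = _ := by ring
  simpa using integral_mono hInt (integrable_const _) hbound
end
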